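/- Let p, q ∈ ℂ[z] be polynomials without multiple roots, each of degree at least 2, and let F : Ve⁰(D_p) → Ve⁰(D_q) be an isomorphism of Lie algebras. Then for every locally nilpotent derivation δ ∈ Ve⁰(D_p), the derivation F(δ) of O(D_q) is locally nilpotent. -/

import Mathlib

open Polynomial

set_option synthInstance.maxHeartbeats 400000
set_option maxHeartbeats 800000

noncomputable section

/-- The polynomial ring `ℂ[x,y,z]` (variables indexed by `Fin 3`). -/
abbrev P3 : Type := MvPolynomial (Fin 3) ℂ

/-- The variable `x`. -/
def xP : P3 := MvPolynomial.X 0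
/-- The variable `y`. -/
def yP : P3 := MvPolynomial.X 1
/-- The variable `z`. -/
def zP : P3 := MvPolynomial.X 2

/-- The ideal `(xy - p(z)) ⊆ ℂ[x,y,z]`. -/
def relIdeal (p : ℂ[X]) : Ideal P3 := Ideal.span {xP * yP - Polynomial.aeval zP p}

/-- The coordinate ring `O(D_p) = ℂ[x,y,z]/(xy - p(z))` of the Danielewski surface `D_p`. -/
abbrev ODan (p : ℂ[X]) : Type := P3 ⧸ relIdeal p

/-- A derivation is locally nilpotent if some power of it kills each element. -/
def IsLND {p : ℂ[X]} (δ : Derivation ℂ (ODan p) (ODan p)) : Prop :=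
  ∀ f : ODan p, ∃ n : ℕ, 1 ≤ n ∧ (δ.toLinearMap ^ n) f = 0

/-- The Lie subalgebra `⟨LND(D_p)⟩` of `Der_ℂ(O(D_p))` generated by all locally
nilpotent derivations. -/
def lndSpan (p : ℂ[X]) : LieSubalgebra ℂ (Derivation ℂ (ODan p) (ODan p)) :=
  LieSubalgebra.lieSpan ℂ _ {δ | IsLND δ}

/-- `Ve⁰(D_p)`: the divergence-zero vector fields on `D_p`, i.e. those derivations of
`O(D_p)` admitting a lift `δ' = ã∂/∂x + b̃∂/∂y + c̃∂/∂z ∈ Der_ℂ(ℂ[x,y,z])` with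
`δ'(xy - p(z)) = 0` and `∂ã/∂x + ∂b̃/∂y + ∂c̃/∂z ∈ (xy - p(z))`. -/
def VeZero (p : ℂ[X]) : Set (Derivation ℂ (ODan p) (ODan p)) :=
  {δ | ∃ δ' : Derivation ℂ P3 P3,
    δ' (xP * yP - Polynomial.aeval zP p) = 0 ∧
    (∀ f : P3, δ (Ideal.Quotient.mk (relIdeal p) f) = Ideal.Quotient.mk (relIdeal p) (δ' f)) ∧
    MvPolynomial.pderiv (0 : Fin 3) (δ' xP) + MvPolynomial.pderiv (1 : Fin 3) (δ' yP) +
      MvPolynomial.pderiv (2 : Fin 3) (δ' zP) ∈ relIdeal p}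

/-- Partial derivatives commute. -/
theorem pd_comm (i j : Fin 3) (f : P3) :
    MvPolynomial.pderiv i (MvPolynomial.pderiv j f) =
      MvPolynomial.pderiv j (MvPolynomial.pderiv i f) := by
  have h : ⁅(MvPolynomial.pderiv i : Derivation ℂ P3 P3), (MvPolynomial.pderiv j : Derivation ℂ P3 P3)⁆ = 0 := by
    apply MvPolynomial.derivation_ext
    intro k
    classical
    rw [Derivation.commutator_apply, MvPolynomial.pderiv_X, MvPolynomial.pderiv_X]
    simp only [Pi.single_apply]
    split_ifs <;> simp
  have h2 := congrArg (fun D : Derivation ℂ P3 P3 => D f) h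
  simp only [Derivation.commutator_apply, Derivation.zero_apply] at h2
  exact sub_eq_zero.mp h2

/-- A derivation of the polynomial ring in coordinates. -/
theorem der_expand (D : Derivation ℂ P3 P3) (f : P3) :
    D f = D xP * MvPolynomial.pderiv 0 f + D yP * MvPolynomial.pderiv 1 f +
      D zP * MvPolynomial.pderiv 2 f := by
  have h : D = D xP • (MvPolynomial.pderiv 0 : Derivation ℂ P3 P3) +
      D yP • (MvPolynomial.pderiv 1 : Derivation ℂ P3 P3) +
      D zP • (MvPolynomial.pderiv 2 : Derivation ℂ P3 P3) := by
    apply MvPolynomial.derivation_ext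
    intro k
    fin_cases k <;> simp [MvPolynomial.pderiv_X, xP, yP, zP]
  have h2 := congrArg (fun D : Derivation ℂ P3 P3 => D f) h
  simpa using h2

/-- The Hamiltonian derivation on the polynomial ring. -/
def ham (P g : P3) : Derivation ℂ P3 P3 :=
  (MvPolynomial.pderiv 1 P * MvPolynomial.pderiv 2 g
      - MvPolynomial.pderiv 2 P * MvPolynomial.pderiv 1 g) • MvPolynomial.pderiv 0 +
  (MvPolynomial.pderiv 2 P * MvPolynomial.pderiv 0 g
      - MvPolynomial.pderiv 0 P * MvPolynomial.pderiv 2 g) • MvPolynomial.pderiv 1 +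
  (MvPolynomial.pderiv 0 P * MvPolynomial.pderiv 1 g
      - MvPolynomial.pderiv 1 P * MvPolynomial.pderiv 0 g) • MvPolynomial.pderiv 2

theorem ham_apply (P g h : P3) : ham P g h =
  (MvPolynomial.pderiv 1 P * MvPolynomial.pderiv 2 g
      - MvPolynomial.pderiv 2 P * MvPolynomial.pderiv 1 g) * MvPolynomial.pderiv 0 h +
  (MvPolynomial.pderiv 2 P * MvPolynomial.pderiv 0 g
      - MvPolynomial.pderiv 0 P * MvPolynomial.pderiv 2 g) * MvPolynomial.pderiv 1 h +
  (MvPolynomial.pderiv 0 P * MvPolynomial.pderiv 1 g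
      - MvPolynomial.pderiv 1 P * MvPolynomial.pderiv 0 g) * MvPolynomial.pderiv 2 h := by
  simp [ham]

theorem ham_x (P g : P3) : ham P g xP = MvPolynomial.pderiv 1 P * MvPolynomial.pderiv 2 g
      - MvPolynomial.pderiv 2 P * MvPolynomial.pderiv 1 g := by
  simp [ham_apply, xP, MvPolynomial.pderiv_X]

theorem ham_y (P g : P3) : ham P g yP = MvPolynomial.pderiv 2 P * MvPolynomial.pderiv 0 g
      - MvPolynomial.pderiv 0 P * MvPolynomial.pderiv 2 g := by
  simp [ham_apply, yP, MvPolynomial.pderiv_X]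

theorem ham_z (P g : P3) : ham P g zP = MvPolynomial.pderiv 0 P * MvPolynomial.pderiv 1 g
      - MvPolynomial.pderiv 1 P * MvPolynomial.pderiv 0 g := by
  simp [ham_apply, zP, MvPolynomial.pderiv_X]

theorem ham_self (P g : P3) : ham P g P = 0 := by
  rw [ham_apply]; ring

theorem ham_div (P g : P3) :
    MvPolynomial.pderiv (0 : Fin 3) (ham P g xP) + MvPolynomial.pderiv (1 : Fin 3) (ham P g yP) +
      MvPolynomial.pderiv (2 : Fin 3) (ham P g zP) = 0 := by
  rw [ham_x, ham_y, ham_z]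
  simp only [map_sub, MvPolynomial.pderiv_mul]
  simp only [pd_comm 1 0 P, pd_comm 2 0 P, pd_comm 2 1 P, pd_comm 1 0 g, pd_comm 2 0 g, pd_comm 2 1 g]
  ring

/-- The key identity: a derivation acts on the Jacobian determinant. -/
theorem der_ham (D : Derivation ℂ P3 P3) (P g h : P3) :
    D (ham P g h) = ham P (D g) h + ham P g (D h) + ham (D P) g h -
      (MvPolynomial.pderiv (0 : Fin 3) (D xP) + MvPolynomial.pderiv (1 : Fin 3) (D yP) +
        MvPolynomial.pderiv (2 : Fin 3) (D zP)) * ham P g h := by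
  simp only [ham_apply]
  simp only [map_add, map_sub, Derivation.leibniz, smul_eq_mul]
  rw [der_expand D g, der_expand D h, der_expand D P]
  simp only [der_expand D (MvPolynomial.pderiv _ _)]
  simp only [map_add, MvPolynomial.pderiv_mul]
  simp only [pd_comm 1 0 g, pd_comm 2 0 g, pd_comm 2 1 g, pd_comm 1 0 h, pd_comm 2 0 h,
    pd_comm 2 1 h, pd_comm 1 0 P, pd_comm 2 0 P, pd_comm 2 1 P]
  ring

/-- The defining polynomial. -/
def defP (p : ℂ[X]) : P3 := xP * yP - Polynomial.aeval zP p

theorem relIdeal_stable (p : ℂ[X]) (D : Derivation ℂ P3 P3) (hD : D (defP p) = 0) (f : P3)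
    (hf : Ideal.Quotient.mk (relIdeal p) f = 0) : Ideal.Quotient.mk (relIdeal p) (D f) = 0 := by
  rw [Ideal.Quotient.eq_zero_iff_mem] at hf ⊢
  unfold relIdeal at hf ⊢
  rw [Ideal.mem_span_singleton] at hf ⊢
  obtain ⟨c, rfl⟩ := hf
  change D (defP p) = 0 at hD
  change defP p ∣ D (defP p * c)
  rw [Derivation.leibniz, hD]
  simp

/-- The Hamiltonian derivation on the quotient. -/
theorem exists_hamQ (p : ℂ[X]) (g : P3) : ∃ δ : Derivation ℂ (ODan p) (ODan p),
    ∀ f : P3, δ (Ideal.Quotient.mk (relIdeal p) f) =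
      Ideal.Quotient.mk (relIdeal p) (ham (defP p) g f) := by
  have hs : Function.Surjective (Ideal.Quotient.mkₐ ℂ (relIdeal p)) :=
    Ideal.Quotient.mkₐ_surjective ℂ _
  have hd : ∀ x, Ideal.Quotient.mkₐ ℂ (relIdeal p) x = 0 →
      Ideal.Quotient.mkₐ ℂ (relIdeal p) (ham (defP p) g x) = 0 := fun x hx =>
    relIdeal_stable p _ (ham_self _ _) x hx
  exact ⟨Derivation.liftOfSurjective hs hd, fun f => Derivation.liftOfSurjective_apply hs hd f⟩

def hamQ (p : ℂ[X]) (g : P3) : Derivation ℂ (ODan p) (ODan p) := (exists_hamQ p g).choose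

theorem hamQ_mk (p : ℂ[X]) (g f : P3) : hamQ p g (Ideal.Quotient.mk (relIdeal p) f) =
    Ideal.Quotient.mk (relIdeal p) (ham (defP p) g f) := (exists_hamQ p g).choose_spec f

theorem hamQ_mem (p : ℂ[X]) (g : P3) : hamQ p g ∈ VeZero p := by
  refine ⟨ham (defP p) g, ham_self _ _, hamQ_mk p g, ?_⟩
  rw [ham_div]
  exact zero_mem _

theorem derQ_ext (p : ℂ[X]) (D E : Derivation ℂ (ODan p) (ODan p))
    (h : ∀ f : P3, D (Ideal.Quotient.mk (relIdeal p) f) = E (Ideal.Quotient.mk (relIdeal p) f)) :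
    D = E := by
  apply Derivation.ext
  intro a
  obtain ⟨f, rfl⟩ := Ideal.Quotient.mk_surjective a
  exact h f

theorem bracket_hamQ (p : ℂ[X]) (δ : Derivation ℂ (ODan p) (ODan p)) (D : Derivation ℂ P3 P3)
    (hD : D (defP p) = 0)
    (hl : ∀ f : P3, δ (Ideal.Quotient.mk (relIdeal p) f) = Ideal.Quotient.mk (relIdeal p) (D f))
    (hdiv : MvPolynomial.pderiv (0 : Fin 3) (D xP) + MvPolynomial.pderiv (1 : Fin 3) (D yP) +
      MvPolynomial.pderiv (2 : Fin 3) (D zP) ∈ relIdeal p) (g : P3) :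
    ⁅δ, hamQ p g⁆ = hamQ p (D g) := by
  apply derQ_ext
  intro f
  rw [Derivation.commutator_apply, hamQ_mk, hl, hl, hamQ_mk, hamQ_mk, der_ham, hD]
  have h0 : ham 0 g f = 0 := by simp [ham_apply]
  rw [h0, ← map_sub, Ideal.Quotient.eq]
  have := (relIdeal p).neg_mem ((relIdeal p).mul_mem_right (ham (defP p) g f) hdiv)
  convert this using 1
  ring

theorem pderiv_aeval_z (i : Fin 3) (p : ℂ[X]) : MvPolynomial.pderiv i (Polynomial.aeval zP p) =
    Polynomial.aeval zP (Polynomial.derivative p) * MvPolynomial.pderiv i zP := by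
  rw [Derivation.map_aeval, smul_eq_mul]

theorem der_zero_of_ham_zero (p : ℂ[X]) (hsp : Squarefree p) (D : Derivation ℂ P3 P3)
    (hD : D (defP p) = 0) (g : P3) (hg : hamQ p g = 0) :
    Ideal.Quotient.mk (relIdeal p) (D g) = 0 := by
  obtain ⟨a, b, hab⟩ := PerfectField.separable_iff_squarefree.mpr hsp
  have hab' := congrArg (Polynomial.aeval zP) hab
  simp only [map_add, map_mul, map_one] at hab'
  have p0 : MvPolynomial.pderiv 0 (defP p) = yP := by
    unfold defP
    rw [map_sub, pderiv_aeval_z]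
    simp [xP, yP, zP, MvPolynomial.pderiv_X]
  have p1 : MvPolynomial.pderiv 1 (defP p) = xP := by
    unfold defP
    rw [map_sub, pderiv_aeval_z]
    simp [xP, yP, zP, MvPolynomial.pderiv_X]
  have p2 : MvPolynomial.pderiv 2 (defP p) = - Polynomial.aeval zP (Polynomial.derivative p) := by
    unfold defP
    rw [map_sub, pderiv_aeval_z]
    simp [xP, yP, zP, MvPolynomial.pderiv_X]
  have hx := hamQ_mk p g xP
  have hy := hamQ_mk p g yP
  have hz := hamQ_mk p g zP
  rw [hg, Derivation.zero_apply] at hx hy hz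
  rw [ham_x, p1, p2] at hx
  rw [ham_y, p0, p2] at hy
  rw [ham_z, p0, p1] at hz
  rw [der_expand, p0, p1, p2] at hD
  have hP : Ideal.Quotient.mk (relIdeal p) (xP * yP - Polynomial.aeval zP p) = 0 :=
    Ideal.Quotient.eq_zero_iff_mem.mpr (Ideal.subset_span rfl)
  rw [der_expand]
  have hab2 := congrArg (Ideal.Quotient.mk (relIdeal p)) hab'
  have hD2 := congrArg (Ideal.Quotient.mk (relIdeal p)) hD
  simp only [map_add, map_sub, map_mul, map_neg, map_one, map_zero] at hx hy hz hP hab2 hD2 ⊢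
  generalize Ideal.Quotient.mk (relIdeal p) (Polynomial.aeval zP (Polynomial.derivative p)) = p' at *
  generalize Ideal.Quotient.mk (relIdeal p) (Polynomial.aeval zP p) = pp at *
  generalize Ideal.Quotient.mk (relIdeal p) (Polynomial.aeval zP a) = a at *
  generalize Ideal.Quotient.mk (relIdeal p) (Polynomial.aeval zP b) = b at *
  generalize Ideal.Quotient.mk (relIdeal p) (MvPolynomial.pderiv 0 g) = g0 at *
  generalize Ideal.Quotient.mk (relIdeal p) (MvPolynomial.pderiv 1 g) = g1 at *
  generalize Ideal.Quotient.mk (relIdeal p) (MvPolynomial.pderiv 2 g) = g2 at *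
  generalize Ideal.Quotient.mk (relIdeal p) (D xP) = d0 at *
  generalize Ideal.Quotient.mk (relIdeal p) (D yP) = d1 at *
  generalize Ideal.Quotient.mk (relIdeal p) (D zP) = d2 at *
  generalize Ideal.Quotient.mk (relIdeal p) xP = x at *
  generalize Ideal.Quotient.mk (relIdeal p) yP = y at *
  linear_combination (-(d0 * g0 + d1 * g1 + d2 * g2)) * hab2
    - a * (d0 * g0 + d1 * g1 + d2 * g2) * hP
    + a * x * (g0 * hD2 - d1 * hz + d2 * hy) - b * (g2 * hD2 - d0 * hy + d1 * hx)

/-- Local nilpotency of `ad δ`, pointwise. -/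
theorem ad_nilp_pointwise {p : ℂ[X]} (δ : Derivation ℂ (ODan p) (ODan p)) (hδ : IsLND δ)
    (E : Derivation ℂ (ODan p) (ODan p)) (m : ℕ) : ∀ f : ODan p, (δ^[m]) f = 0 →
      ∃ N, ∀ n, N ≤ n → ((fun e => ⁅δ, e⁆)^[n] E) f = 0 := by
  induction m with
  | zero =>
    intro f hf
    simp only [Function.iterate_zero, id] at hf
    exact ⟨0, fun n _ => by rw [hf, map_zero]⟩
  | succ m ih =>
    intro f hf
    rw [Function.iterate_succ_apply] at hf
    obtain ⟨N, hN⟩ := ih (δ f) hf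
    have key : ∀ k, ((fun e => ⁅δ, e⁆)^[N + k] E) f =
        (δ.toLinearMap ^ k) (((fun e => ⁅δ, e⁆)^[N] E) f) := by
      intro k
      induction k with
      | zero => simp
      | succ k ihk =>
        rw [← add_assoc, Function.iterate_succ_apply', Derivation.commutator_apply,
          hN _ (Nat.le_add_right _ _), sub_zero, ihk, pow_succ']
        rfl
    obtain ⟨k, -, hk⟩ := hδ (((fun e => ⁅δ, e⁆)^[N] E) f)
    refine ⟨N + k, fun n hn => ?_⟩
    obtain ⟨j, rfl⟩ := Nat.exists_eq_add_of_le hn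
    rw [add_assoc, key, add_comm k j, pow_add, Module.End.mul_apply, hk, map_zero]

theorem ad_nilp {p : ℂ[X]} (δ : Derivation ℂ (ODan p) (ODan p)) (hδ : IsLND δ)
    (E : Derivation ℂ (ODan p) (ODan p)) : ∃ n, (fun e => ⁅δ, e⁆)^[n] E = 0 := by
  have h : ∀ f : ODan p, ∃ N, ∀ n, N ≤ n → ((fun e => ⁅δ, e⁆)^[n] E) f = 0 := by
    intro f
    obtain ⟨m, -, hm⟩ := hδ f
    refine ad_nilp_pointwise δ hδ E m f ?_
    rw [Module.End.pow_apply] at hm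
    exact hm
  choose N hN using fun i : Fin 3 => h (Ideal.Quotient.mk (relIdeal p) (MvPolynomial.X i))
  refine ⟨N 0 + N 1 + N 2, ?_⟩
  set E' := (fun e => ⁅δ, e⁆)^[N 0 + N 1 + N 2] E with hE'
  have hX : ∀ i : Fin 3, E' (Ideal.Quotient.mk (relIdeal p) (MvPolynomial.X i)) = 0 := by
    intro i
    apply hN
    fin_cases i <;> simp <;> omega
  apply derQ_ext
  intro f
  rw [Derivation.zero_apply]
  induction f using MvPolynomial.induction_on with
  | C c =>
    have : Ideal.Quotient.mk (relIdeal p) (MvPolynomial.C c) = algebraMap ℂ (ODan p) c := rfl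
    rw [this, Derivation.map_algebraMap]
  | add f g hf hg => rw [map_add, map_add, hf, hg, add_zero]
  | mul_X f i hf => rw [map_mul, Derivation.leibniz, hf, hX, smul_zero, smul_zero, add_zero]

/-- Let `p, q` be squarefree of degree at least `2`, and `F : Ve⁰(D_p) → Ve⁰(D_q)` an
isomorphism of Lie algebras.  Then `F` sends locally nilpotent derivations to locally
nilpotent derivations. -/
theorem veZero_equiv_preserves_lnd (p q : ℂ[X])
    (hsp : Squarefree p) (hsq : Squarefree q)
    (hp2 : 2 ≤ p.natDegree) (hq2 : 2 ≤ q.natDegree)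
    (Vp : LieSubalgebra ℂ (Derivation ℂ (ODan p) (ODan p))) (hVp : (Vp : Set _) = VeZero p)
    (Vq : LieSubalgebra ℂ (Derivation ℂ (ODan q) (ODan q))) (hVq : (Vq : Set _) = VeZero q)
    (F : Vp ≃ₗ⁅ℂ⁆ Vq) :
    ∀ d : Vp, IsLND ((d : Vp) : Derivation ℂ (ODan p) (ODan p)) →
      IsLND ((F d : Vq) : Derivation ℂ (ODan q) (ODan q)) := by
  intro d hd f
  obtain ⟨D, hD, hl, hdiv⟩ : ((F d : Vq) : Derivation ℂ (ODan q) (ODan q)) ∈ VeZero q := by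
    rw [← hVq]; exact (F d).2
  obtain ⟨g, rfl⟩ := Ideal.Quotient.mk_surjective f
  have hmem : hamQ q g ∈ Vq := by
    rw [← SetLike.mem_coe, hVq]; exact hamQ_mem q g
  obtain ⟨e, he⟩ := F.surjective ⟨hamQ q g, hmem⟩
  have hcoe : ∀ n, ((((fun e : Vp => ⁅d, e⁆)^[n] e : Vp)) : Derivation ℂ (ODan p) (ODan p)) =
      (fun e : Derivation ℂ (ODan p) (ODan p) =>
        ⁅(d : Derivation ℂ (ODan p) (ODan p)), e⁆)^[n] (e : Derivation ℂ (ODan p) (ODan p)) := by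
    intro n
    induction n with
    | zero => rfl
    | succ n ih => rw [Function.iterate_succ_apply', Function.iterate_succ_apply', ← ih]; rfl
  have hF : ∀ n, ((F ((fun e : Vp => ⁅d, e⁆)^[n] e) : Vq) : Derivation ℂ (ODan q) (ODan q)) =
      hamQ q (D^[n] g) := by
    intro n
    induction n with
    | zero => exact congrArg Subtype.val he
    | succ n ih =>
      rw [Function.iterate_succ_apply', Function.iterate_succ_apply', LieEquiv.map_lie,
        LieSubalgebra.coe_bracket, ih]
      exact bracket_hamQ q _ D hD hl hdiv _
  have hpow : ∀ n, (((F d : Vq) : Derivation ℂ (ODan q) (ODan q)).toLinearMap ^ n)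
      (Ideal.Quotient.mk (relIdeal q) g) = Ideal.Quotient.mk (relIdeal q) (D^[n] g) := by
    intro n
    induction n with
    | zero => rfl
    | succ n ih =>
      rw [pow_succ', Module.End.mul_apply, ih, Function.iterate_succ_apply']
      exact hl _
  obtain ⟨n, hn⟩ := ad_nilp (d : Derivation ℂ (ODan p) (ODan p)) hd e
  have h0 : (fun e : Vp => ⁅d, e⁆)^[n] e = 0 := by
    apply Subtype.ext
    rw [hcoe, hn]; rfl
  have h1 := hF n
  rw [h0, map_zero] at h1
  refine ⟨n + 1, by omega, ?_⟩
  rw [hpow, Function.iterate_succ_apply']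
  exact der_zero_of_ham_zero q hsq D hD _ h1.symm

end
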